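/- Let γ ∈ L be a primitive element (a generator of the multiplicative group L*). Every maximal left P-independent subset of L* is of the form {σ(c_{ij})·γ^i·c_{ij}^{−1} : 0 ≤ i ≤ p^δ − 2, 0 ≤ j ≤ μ − 1}, where for each i = 0, …, p^δ − 2 the set {c_{i0}, …, c_{i,μ−1}} is a K-basis of L. As a consequence, every left P-independent subset of L* has at most (p^δ − 1)·μ elements. -/

import Mathlib

/-- `δ` is a `σ`-derivation of the field `L`. -/
def IsSigmaDerivation {L : Type*} [Field L] (σ : L ≃+* L) (δ : L → L) : Prop :=
  (∀ a b : L, δ (a + b) = δ a + δ b) ∧ ∀ a b : L, δ (a * b) = σ a * δ b + δ a * b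

/-- The ring `R`, together with the embedding of constants `C : L →+* R` and the
element `X`, is the Ore extension `L[x;σ,δ]`: the twisting rule
`X * C a = C (σ a) * X + C (δ a)` holds and every element of `R` is, in a unique way,
a left `L`-linear combination of the powers of `X`. -/
structure IsOreExtension {L : Type*} [Field L] (σ : L ≃+* L) (δ : L → L)
    (R : Type*) [Ring R] (C : L →+* R) (X : R) : Prop where
  twist : ∀ a : L, X * C a = C (σ a) * X + C (δ a)
  repr_unique : ∀ r : R, ∃! f : ℕ →₀ L, r = f.sum fun n a => C a * X ^ n

/-- The degree of an Ore polynomial (`⊥` for the zero polynomial). -/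
noncomputable def IsOreExtension.deg {L : Type*} [Field L] {σ : L ≃+* L} {δ : L → L}
    {R : Type*} [Ring R] {C : L →+* R} {X : R}
    (H : IsOreExtension σ δ R C X) (r : R) : WithBot ℕ :=
  (H.repr_unique r).exists.choose.support.max

/-- `f` is a right divisor of `g` : `g = u * f` for some `u`. -/
def RDvd {R : Type*} [Ring R] (f g : R) : Prop := ∃ u, g = u * f

/-- `f` is a left divisor of `g` : `g = f * u` for some `u`. -/
def LDvd {R : Type*} [Ring R] (f g : R) : Prop := ∃ u, g = f * u

/-- `m` is a least common left multiple of the family `f`. -/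
def IsLclm {R : Type*} [Ring R] {ι : Type*} (f : ι → R) (m : R) : Prop :=
  (∀ i, RDvd (f i) m) ∧ ∀ m' : R, (∀ i, RDvd (f i) m') → RDvd m m'

/-- `m` is a least common right multiple of the family `f`. -/
def IsLcrm {R : Type*} [Ring R] {ι : Type*} (f : ι → R) (m : R) : Prop :=
  (∀ i, LDvd (f i) m) ∧ ∀ m' : R, (∀ i, LDvd (f i) m') → LDvd m m'

/-- `gcld (f, g) = 1`, i.e. `fR + gR = R`. -/
def LCoprime {R : Type*} [Ring R] (f g : R) : Prop := ∃ a b : R, f * a + g * b = 1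

/-- `gcrd (f, g) = 1`, i.e. `Rf + Rg = R`. -/
def RCoprime {R : Type*} [Ring R] (f g : R) : Prop := ∃ a b : R, a * f + b * g = 1

/-- The finite subset `Γ ⊆ L` is left P-independent: the least common left multiple
of the linear polynomials `x - b`, `b ∈ Γ`, has degree `|Γ|`. -/
def PIndepF {L : Type*} [Field L] {σ : L ≃+* L} {δ : L → L}
    {R : Type*} [Ring R] {C : L →+* R} {X : R}
    (H : IsOreExtension σ δ R C X) (Γ : Finset L) : Prop :=
  ∃ Λ : R,
    ((∀ b ∈ Γ, RDvd (X - C b) Λ) ∧ ∀ m' : R, (∀ b ∈ Γ, RDvd (X - C b) m') → RDvd Λ m') ∧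
    H.deg Λ = (Γ.card : WithBot ℕ)

theorem IsOreExtension.sum_bijective {L : Type*} [Field L] {σ : L ≃+* L} {δ : L → L}
    {R : Type*} [Ring R] {C : L →+* R} {X : R} (H : IsOreExtension σ δ R C X) :
    Function.Bijective (Finsupp.liftAddHom fun n : ℕ =>
      (AddMonoidHom.mulRight (X ^ n)).comp (C : L →+ R)) := by
  refine ⟨fun f g h => ?_, fun r => ?_⟩
  · exact (H.repr_unique _).unique rfl h
  · obtain ⟨f, hf, -⟩ := H.repr_unique r
    exact ⟨f, hf.symm⟩

/-- The coefficients of an Ore polynomial. -/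
noncomputable def IsOreExtension.coeff {L : Type*} [Field L] {σ : L ≃+* L} {δ : L → L}
    {R : Type*} [Ring R] {C : L →+* R} {X : R} (H : IsOreExtension σ δ R C X) :
    R ≃+ (ℕ →₀ L) :=
  (AddEquiv.ofBijective _ H.sum_bijective).symm

/-- The truncated norms `1, b, σ(b) * b, …`, which are the values of `X ^ n` at `b`. -/
def skewNorm {L : Type*} [Field L] (σ : L ≃+* L) (b : L) : ℕ → L
  | 0 => 1
  | n + 1 => σ (skewNorm σ b n) * b

/-- The vectors `(skewNorm σ b n)ₙ`, `b ∈ Γ`, are linearly independent over `L`. -/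
def NormIndep {L : Type*} [Field L] (σ : L ≃+* L) (Γ : Finset L) : Prop :=
  ∀ c : L → L, (∀ n, ∑ b ∈ Γ, c b * skewNorm σ b n = 0) → ∀ b ∈ Γ, c b = 0

theorem exists_ne_zero_sum_mul_eq_zero {L ι κ : Type*} [Field L] [Fintype ι] [Fintype κ]
    (f : ι → κ → L) (h : Fintype.card κ < Fintype.card ι) :
    ∃ x : ι → L, x ≠ 0 ∧ ∀ k, ∑ i, x i * f i k = 0 := by
  obtain ⟨x, hx, hx0⟩ := Submodule.exists_mem_ne_zero_of_ne_bot
    (LinearMap.ker_ne_bot_of_finrank_lt (f := Matrix.vecMulLinear (Matrix.of f)) (by simpa using h))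
  exact ⟨x, hx0, fun k => congrFun hx k⟩

namespace IsOreExtension

section Coeff

variable {L : Type*} [Field L] {σ : L ≃+* L} {δ : L → L}
    {R : Type*} [Ring R] {C : L →+* R} {X : R} (H : IsOreExtension σ δ R C X)

theorem sum_coeff (r : R) : ((H.coeff r).sum fun n a => C a * X ^ n) = r :=
  H.coeff.symm_apply_apply r

theorem coeff_C_mul_X_pow (a : L) (n : ℕ) :
    H.coeff (C a * X ^ n) = Finsupp.single n a := by
  rw [← AddEquiv.eq_symm_apply]
  change _ = (Finsupp.single n a).sum fun n a => C a * X ^ n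
  simp

theorem deg_eq (r : R) : H.deg r = (H.coeff r).support.max := by
  have h := (H.repr_unique r).exists.choose_spec
  rw [IsOreExtension.deg, (H.repr_unique r).unique h (H.sum_coeff r).symm]

include H in
theorem induction_on {P : R → Prop} (r : R) (zero : P 0) (add : ∀ f g, P f → P g → P (f + g))
    (term : ∀ a n, P (C a * X ^ n)) : P r := by
  rw [← H.sum_coeff r]
  exact Finset.sum_induction _ P add zero fun n _ => term _ n

/-- The remainder of `r` after right division by `X - C b`. -/
noncomputable def eval (b : L) : R →+ L :=
  (Finsupp.liftAddHom fun n : ℕ => AddMonoidHom.mulRight (skewNorm σ b n)).comp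
    (H.coeff : R →+ (ℕ →₀ L))

theorem eval_apply (b : L) (r : R) :
    H.eval b r = (H.coeff r).sum fun n a => a * skewNorm σ b n := rfl

theorem eval_C_mul_X_pow (a b : L) (n : ℕ) :
    H.eval b (C a * X ^ n) = a * skewNorm σ b n := by
  rw [eval_apply, coeff_C_mul_X_pow, Finsupp.sum_single_index (zero_mul _)]

theorem ne_zero_of_deg_eq {r : R} {k : ℕ} (h : H.deg r = k) : H.coeff r k ≠ 0 := by
  rw [deg_eq] at h
  exact Finsupp.mem_support_iff.1 (Finset.mem_of_max h)

theorem deg_eq_coe_iff {r : R} {k : ℕ} :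
    H.deg r = k ↔ H.coeff r k ≠ 0 ∧ ∀ j, k < j → H.coeff r j = 0 := by
  refine ⟨fun h => ⟨H.ne_zero_of_deg_eq h, fun j hj => ?_⟩, fun ⟨h, h'⟩ => ?_⟩
  · rw [deg_eq] at h
    by_contra hne
    exact hj.not_ge (Finset.le_max_of_eq (Finsupp.mem_support_iff.2 hne) h)
  · rw [deg_eq]
    refine le_antisymm (Finset.max_le fun j hj => ?_)
      (Finset.le_max (Finsupp.mem_support_iff.2 h))
    by_contra hlt
    exact Finsupp.mem_support_iff.1 hj (h' j ((Nat.cast_lt (α := WithBot ℕ)).1 (not_le.1 hlt)))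

theorem exists_ne_zero_eval_eq_zero (Γ : Finset L) {n : ℕ} (h : Γ.card < n) :
    ∃ r : R, r ≠ 0 ∧ (∀ j, n ≤ j → H.coeff r j = 0) ∧ ∀ b ∈ Γ, H.eval b r = 0 := by
  obtain ⟨x, hx0, hx⟩ := exists_ne_zero_sum_mul_eq_zero
    (fun (k : Fin n) (b : Γ) => skewNorm σ (b : L) k) (by simpa using h)
  have hc : ∀ j, H.coeff (∑ k : Fin n, C (x k) * X ^ (k : ℕ)) j =
      ∑ k : Fin n, if (k : ℕ) = j then x k else 0 := fun j => by
    simp [map_sum, coeff_C_mul_X_pow, Finsupp.finsetSum_apply, Finsupp.single_apply]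
  refine ⟨∑ k : Fin n, C (x k) * X ^ (k : ℕ), fun h0 => hx0 ?_, fun j hj => ?_, fun b hb => ?_⟩
  · ext k
    have := hc k
    rw [h0] at this
    simpa [Fin.val_inj] using this.symm
  · rw [hc]
    exact Finset.sum_eq_zero fun k _ => if_neg (by omega)
  · simpa [map_sum, eval_C_mul_X_pow] using hx ⟨b, hb⟩

theorem sum_mul_eval_eq_zero {Γ : Finset L} {c : L → L} {r : R}
    (h : ∀ n, H.coeff r n ≠ 0 → ∑ b ∈ Γ, c b * skewNorm σ b n = 0) :
    ∑ b ∈ Γ, c b * H.eval b r = 0 := by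
  simp only [eval_apply, Finsupp.sum, Finset.mul_sum]
  rw [Finset.sum_comm]
  refine Finset.sum_eq_zero fun n hn => ?_
  rw [← mul_zero (H.coeff r n), ← h n (Finsupp.mem_support_iff.1 hn), Finset.mul_sum]
  exact Finset.sum_congr rfl fun b _ => by ring

end Coeff

section ZeroDerivation

variable {L : Type*} [Field L] {σ : L ≃+* L} {R : Type*} [Ring R] {C : L →+* R} {X : R}
    (H : IsOreExtension σ (fun _ => 0) R C X)

include H in
theorem X_pow_mul_C (n : ℕ) (a : L) : X ^ n * C a = C (σ^[n] a) * X ^ n := by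
  induction n generalizing a with
  | zero => simp
  | succ n ih =>
    rw [pow_succ, mul_assoc, H.twist, map_zero, add_zero, ← mul_assoc, ih, mul_assoc,
      Function.iterate_succ_apply]

include H in
theorem term_mul_term (a b : L) (n k : ℕ) :
    C a * X ^ n * (C b * X ^ k) = C (a * σ^[n] b) * X ^ (n + k) := by
  rw [mul_assoc, ← mul_assoc (X ^ n), H.X_pow_mul_C, map_mul, pow_add]
  simp only [mul_assoc]

theorem coeff_term_mul (a : L) (n j : ℕ) (r : R) :
    H.coeff (C a * X ^ n * r) (n + j) = a * σ^[n] (H.coeff r j) := by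
  induction r using H.induction_on with
  | zero => simp [iterate_map_zero]
  | add f g hf hg => simp only [mul_add, map_add, Finsupp.add_apply, hf, hg, iterate_map_add]
  | term b k =>
    rw [H.term_mul_term, coeff_C_mul_X_pow, coeff_C_mul_X_pow, Finsupp.single_apply,
      Finsupp.single_apply]
    by_cases hk : k = j <;> simp [hk, iterate_map_zero]

theorem skewNorm_succ' (b : L) (n : ℕ) :
    skewNorm σ b (n + 1) = σ^[n] b * skewNorm σ b n := by
  induction n with
  | zero => simp [skewNorm]
  | succ n ih =>
    rw [Function.iterate_succ_apply']
    change σ (skewNorm σ b (n + 1)) * b = σ (σ^[n] b) * (σ (skewNorm σ b n) * b)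
    rw [ih, map_mul, mul_assoc]

theorem eval_mul_X_sub_C (b : L) (u : R) : H.eval b (u * (X - C b)) = 0 := by
  induction u using H.induction_on with
  | zero => simp
  | add f g hf hg => rw [add_mul, map_add, hf, hg, add_zero]
  | term a n =>
    have h := H.term_mul_term a b n 0
    rw [pow_zero, mul_one, add_zero] at h
    rw [mul_sub, mul_assoc, ← pow_succ, h, map_sub, eval_C_mul_X_pow, eval_C_mul_X_pow,
      skewNorm_succ']
    ring

theorem rDvd_sub_C_eval (b : L) (r : R) : RDvd (X - C b) (r - C (H.eval b r)) := by
  induction r using H.induction_on with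
  | zero => exact ⟨0, by simp⟩
  | add f g hf hg =>
    obtain ⟨u, hu⟩ := hf
    obtain ⟨v, hv⟩ := hg
    refine ⟨u + v, ?_⟩
    rw [add_mul, ← hu, ← hv, map_add, map_add]
    abel
  | term a n =>
    rw [eval_C_mul_X_pow, map_mul, ← mul_sub]
    suffices RDvd (X - C b) (X ^ n - C (skewNorm σ b n)) by
      obtain ⟨u, hu⟩ := this
      exact ⟨C a * u, by rw [hu, mul_assoc]⟩
    induction n with
    | zero => exact ⟨0, by simp [skewNorm]⟩
    | succ n ih =>
      obtain ⟨u, hu⟩ := ih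
      refine ⟨X * u + C (σ (skewNorm σ b n)), ?_⟩
      have h := H.twist (skewNorm σ b n)
      rw [map_zero, add_zero] at h
      rw [add_mul, mul_assoc, ← hu, mul_sub, h, skewNorm, map_mul, pow_succ']
      noncomm_ring

theorem rDvd_X_sub_C_iff {b : L} {r : R} : RDvd (X - C b) r ↔ H.eval b r = 0 := by
  refine ⟨fun ⟨u, hu⟩ => hu ▸ H.eval_mul_X_sub_C b u, fun h => ?_⟩
  simpa [h] using H.rDvd_sub_C_eval b r

theorem eval_mul_of_eval_eq_zero {b : L} {r : R} (u : R) (h : H.eval b r = 0) :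
    H.eval b (u * r) = 0 := by
  obtain ⟨v, hv⟩ := H.rDvd_X_sub_C_iff.2 h
  exact H.rDvd_X_sub_C_iff.1 ⟨u * v, by rw [hv, mul_assoc]⟩

theorem exists_coeff_mul_ne_zero {u r : R} {k : ℕ} (hu : u ≠ 0) (hr : H.deg r = k) :
    ∃ j, k ≤ j ∧ H.coeff (u * r) j ≠ 0 := by
  obtain ⟨hk, hk'⟩ := H.deg_eq_coe_iff.1 hr
  have hne : (H.coeff u).support.Nonempty := by
    rw [Finsupp.support_nonempty_iff]
    simpa using hu
  set N := (H.coeff u).support.max' hne with hN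
  have hNm : N ∈ (H.coeff u).support := Finset.max'_mem _ _
  refine ⟨N + k, by omega, ?_⟩
  have h : H.coeff (u * r) (N + k) = H.coeff u N * σ^[N] (H.coeff r k) := by
    conv_lhs => rw [← H.sum_coeff u]
    rw [Finsupp.sum, Finset.sum_mul, map_sum, Finsupp.finsetSum_apply,
      Finset.sum_eq_single_of_mem N hNm, coeff_term_mul]
    intro n hn hnN
    have hle : n ≤ N := Finset.le_max' _ _ hn
    obtain ⟨e, he⟩ := Nat.exists_eq_add_of_le hle
    rw [he, add_assoc, coeff_term_mul, hk' _ (by omega), iterate_map_zero, mul_zero]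
  rw [h]
  refine mul_ne_zero (Finsupp.mem_support_iff.1 hNm) fun h0 => hk ?_
  exact (σ.injective.iterate N) (h0.trans (iterate_map_zero σ N).symm)

theorem exists_sub_mul_coeff_eq_zero {r : R} {k : ℕ} (hr : H.deg r = k) (f : R) :
    ∃ u, ∀ j, k ≤ j → H.coeff (f - u * r) j = 0 := by
  obtain ⟨hk, hk'⟩ := H.deg_eq_coe_iff.1 hr
  suffices ∀ N, ∀ f : R, (∀ j, k + N ≤ j → H.coeff f j = 0) →
      ∃ u, ∀ j, k ≤ j → H.coeff (f - u * r) j = 0 by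
    refine this ((H.coeff f).support.sup id + 1) f fun j hj => ?_
    by_contra hne
    have := Finset.le_sup (f := id) (Finsupp.mem_support_iff.2 hne)
    simp only [id] at this
    omega
  intro N
  induction N with
  | zero => exact fun f hf => ⟨0, by simpa using hf⟩
  | succ N ih =>
    intro f hf
    have hσ : σ^[N] (H.coeff r k) ≠ 0 := fun h0 =>
      hk ((σ.injective.iterate N) (h0.trans (iterate_map_zero σ N).symm))
    set a := H.coeff f (N + k) / σ^[N] (H.coeff r k) with ha
    obtain ⟨u, hu⟩ := ih (f - C a * X ^ N * r) fun j hj => by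
      obtain ⟨e, rfl⟩ := Nat.exists_eq_add_of_le hj
      rw [map_sub, Finsupp.sub_apply, show k + N + e = N + (k + e) by ring, coeff_term_mul]
      rcases Nat.eq_zero_or_pos e with rfl | he
      · rw [add_zero, ha, div_mul_cancel₀ _ hσ, sub_self]
      · rw [hf _ (by omega), hk' _ (by omega), iterate_map_zero, mul_zero, sub_zero]
    refine ⟨u + C a * X ^ N, fun j hj => ?_⟩
    rw [add_mul, add_comm, ← sub_sub]
    exact hu j hj

theorem pIndepF_iff {Γ : Finset L} : PIndepF H Γ ↔ NormIndep σ Γ := by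
  classical
  constructor
  · rintro ⟨Λ, ⟨-, hΛ⟩, hdeg⟩ c hc b₀ hb₀
    by_contra hne
    obtain ⟨r, hr0, hr, hΓr⟩ := H.exists_ne_zero_eval_eq_zero (Γ.erase b₀)
      (Finset.card_erase_lt_of_mem hb₀)
    obtain ⟨u, hu⟩ := hΛ r fun b hb => H.rDvd_X_sub_C_iff.2 <| by
      by_cases hbb : b = b₀
      · have h := H.sum_mul_eval_eq_zero (r := r) fun n _ => hc n
        rw [Finset.sum_eq_single_of_mem b₀ hb₀ fun b hb hbne => by
          rw [hΓr b (Finset.mem_erase.2 ⟨hbne, hb⟩), mul_zero]] at h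
        exact hbb ▸ (mul_eq_zero.1 h).resolve_left hne
      · exact hΓr b (Finset.mem_erase.2 ⟨hbb, hb⟩)
    obtain ⟨j, hj, hj'⟩ := H.exists_coeff_mul_ne_zero
      (u := u) (by rintro rfl; exact hr0 (by simpa using hu)) hdeg
    exact hj' (hu ▸ hr j hj)
  · intro hΓ
    have hex : ∃ k : ℕ, ∃ r : R, H.deg r = k ∧ ∀ b ∈ Γ, H.eval b r = 0 := by
      obtain ⟨r, hr0, -, hr⟩ := H.exists_ne_zero_eval_eq_zero Γ (Nat.lt_succ_self _)
      have hne : (H.coeff r).support.Nonempty := by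
        rw [Finsupp.support_nonempty_iff]
        simpa using hr0
      exact ⟨_, r, (H.deg_eq r).trans (Finset.coe_max' hne).symm, hr⟩
    obtain ⟨Λ, hdeg, hΛ⟩ := Nat.find_spec hex
    set k := Nat.find hex with hk
    have hmin : ∀ r : R, (∀ j, k ≤ j → H.coeff r j = 0) → (∀ b ∈ Γ, H.eval b r = 0) →
        r = 0 := by
      intro r hr hr'
      by_contra hr0
      have hne : (H.coeff r).support.Nonempty := by
        rw [Finsupp.support_nonempty_iff]
        simpa using hr0
      refine Finsupp.mem_support_iff.1 (Finset.max'_mem _ hne) (hr _ ?_)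
      exact Nat.find_min' hex ⟨r, (H.deg_eq r).trans (Finset.coe_max' hne).symm, hr'⟩
    refine ⟨Λ, ⟨fun b hb => H.rDvd_X_sub_C_iff.2 (hΛ b hb), fun f hf => ?_⟩, ?_⟩
    · obtain ⟨u, hu⟩ := H.exists_sub_mul_coeff_eq_zero hdeg f
      refine ⟨u, sub_eq_zero.1 (hmin _ hu fun b hb => ?_)⟩
      rw [map_sub, H.rDvd_X_sub_C_iff.1 (hf b hb), H.eval_mul_of_eval_eq_zero u (hΛ b hb),
        sub_zero]
    · rw [hdeg, Nat.cast_inj]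
      refine le_antisymm ?_ ?_
      · by_contra! hlt
        obtain ⟨r, hr0, hr, hr'⟩ := H.exists_ne_zero_eval_eq_zero Γ hlt
        exact hr0 (hmin r hr hr')
      · by_contra! hlt
        obtain ⟨x, hx0, hx⟩ := exists_ne_zero_sum_mul_eq_zero
          (fun (b : Γ) (n : Fin k) => skewNorm σ (b : L) n) (by simpa using hlt)
        set c : L → L := fun b => if hb : b ∈ Γ then x ⟨b, hb⟩ else 0 with hc
        have hsum : ∀ g : L → L, ∑ b ∈ Γ, c b * g b = ∑ b : Γ, x b * g b := fun g => by
          rw [← Finset.sum_coe_sort]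
          exact Finset.sum_congr rfl fun b _ => by simp [hc]
        have hlow : ∀ r : R, (∀ j, k ≤ j → H.coeff r j = 0) →
            ∑ b ∈ Γ, c b * H.eval b r = 0 := fun r hr =>
          H.sum_mul_eval_eq_zero fun n hn => by
            rw [hsum]
            exact hx ⟨n, by by_contra! h; exact hn (hr n h)⟩
        have hall := hΓ c fun n => by
          obtain ⟨u, hu⟩ := H.exists_sub_mul_coeff_eq_zero hdeg (C 1 * X ^ n)
          rw [← hlow _ hu]
          refine Finset.sum_congr rfl fun b hb => ?_
          rw [map_sub, H.eval_mul_of_eval_eq_zero u (hΛ b hb), sub_zero, eval_C_mul_X_pow,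
            one_mul]
        refine hx0 (funext fun b => ?_)
        simpa [hc] using hall b b.2

end ZeroDerivation

end IsOreExtension

section NormIndep

variable {L : Type*} [Field L] {σ : L ≃+* L}

theorem skewNorm_conj_mul (g : L) {c : L} (hc : c ≠ 0) (n : ℕ) :
    skewNorm σ (σ c * g * c⁻¹) n * c = σ^[n] c * skewNorm σ g n := by
  induction n with
  | zero => simp [skewNorm]
  | succ n ih =>
    have h := congrArg σ ih
    rw [map_mul, map_mul] at h
    rw [skewNorm, skewNorm, Function.iterate_succ_apply']
    calc _ = σ (skewNorm σ (σ c * g * c⁻¹) n) * σ c * g * (c⁻¹ * c) := by ring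
      _ = _ := by rw [h, inv_mul_cancel₀ hc]; ring

theorem NormIndep.subset {Γ S : Finset L} (h : NormIndep σ Γ) (hS : S ⊆ Γ) :
    NormIndep σ S := by
  classical
  intro c hc b hb
  have := h (fun b => if b ∈ S then c b else 0) (fun n => by
    rw [← Finset.sum_subset hS fun b _ hb => by rw [if_neg hb, zero_mul], ← hc n]
    exact Finset.sum_congr rfl fun b hb => by simp [hb]) b (hS hb)
  simpa [hb] using this

theorem NormIndep.eq_zero_of_sum_mul_eq_zero {Γ : Finset L} (h : NormIndep σ Γ) {g : L}
    {c t : L → L} (hc0 : ∀ b ∈ Γ, c b ≠ 0) (hc : ∀ b ∈ Γ, b = σ (c b) * g * (c b)⁻¹)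
    (ht : ∀ b ∈ Γ, σ (t b) = t b) (hsum : ∑ b ∈ Γ, t b * c b = 0) : ∀ b ∈ Γ, t b = 0 := by
  intro b hb
  refine (mul_eq_zero.1 (h (fun b => t b * c b) (fun n => ?_) b hb)).resolve_right (hc0 b hb)
  calc ∑ b ∈ Γ, t b * c b * skewNorm σ b n
      = ∑ b ∈ Γ, (σ ^ n) (t b * c b) * skewNorm σ g n := by
        refine Finset.sum_congr rfl fun b hb => ?_
        have h₁ := skewNorm_conj_mul (σ := σ) g (hc0 b hb) n
        rw [← hc b hb] at h₁
        have h₂ : (σ ^ n) (t b * c b) = t b * σ^[n] (c b) := by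
          rw [RingAut.coe_pow, iterate_map_mul, Function.iterate_fixed (ht b hb)]
        rw [h₂, mul_assoc, mul_assoc, mul_comm (c b), h₁]
    _ = 0 := by rw [← Finset.sum_mul, ← map_sum, hsum, map_zero, zero_mul]

theorem exists_conj_relation {Γ : Finset L} (h : ¬ NormIndep σ Γ) :
    ∃ c : L → L, ∃ b₀ ∈ Γ, c b₀ = 1 ∧ (∀ n, ∑ b ∈ Γ, c b * skewNorm σ b n = 0) ∧
      ∀ b ∈ Γ, c b * b = b₀ * σ (c b) := by
  classical
  induction Γ using Finset.strongInduction with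
  | H Γ ih =>
    by_cases hsub : ∃ b ∈ Γ, ¬ NormIndep σ (Γ.erase b)
    · obtain ⟨b₁, hb₁, hdep⟩ := hsub
      obtain ⟨c, b₀, hb₀, hc1, hc, hconj⟩ := ih _ (Finset.erase_ssubset hb₁) hdep
      refine ⟨Function.update c b₁ 0, b₀, Finset.mem_of_mem_erase hb₀, ?_, fun n => ?_,
        fun b hb => ?_⟩
      · rwa [Function.update_of_ne (Finset.ne_of_mem_erase hb₀)]
      · rw [← Finset.add_sum_erase _ _ hb₁, Function.update_self, zero_mul, zero_add, ← hc n]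
        refine Finset.sum_congr rfl fun b hb => ?_
        rw [Function.update_of_ne (Finset.ne_of_mem_erase hb)]
      · by_cases hbb : b = b₁
        · simp [hbb]
        · rw [Function.update_of_ne hbb]
          exact hconj b (Finset.mem_erase.2 ⟨hbb, hb⟩)
    · push Not at hsub
      simp only [NormIndep] at h
      push Not at h
      obtain ⟨c, hc, b₀, hb₀, hne⟩ := h
      have hc' : ∀ n, ∑ b ∈ Γ, c b / c b₀ * skewNorm σ b n = 0 := fun n => by
        rw [← mul_zero (c b₀)⁻¹, ← hc n, Finset.mul_sum]
        exact Finset.sum_congr rfl fun b _ => by ring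
      refine ⟨fun b => c b / c b₀, b₀, hb₀, div_self hne, hc', fun b hb => ?_⟩
      set e : L → L := fun b => σ.symm (c b / c b₀ * b) - σ.symm b₀ * (c b / c b₀) with he
      have he₀ : e b₀ = 0 := by simp only [he, div_self hne, one_mul, mul_one, sub_self]
      have hesum : ∀ n, ∑ b ∈ Γ, e b * skewNorm σ b n = 0 := fun n => by
        have h₁ : ∑ b ∈ Γ, σ.symm (c b / c b₀ * b) * skewNorm σ b n = 0 := by
          refine σ.injective ?_
          rw [map_sum, map_zero, ← hc' (n + 1)]
          refine Finset.sum_congr rfl fun b _ => ?_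
          rw [map_mul, σ.apply_symm_apply, skewNorm]
          ring
        have h₂ := congrArg (σ.symm b₀ * ·) (hc' n)
        simp only [mul_zero, Finset.mul_sum] at h₂
        rw [← sub_zero (0 : L)]
        nth_rewrite 1 [← h₁]
        nth_rewrite 1 [← h₂]
        rw [← Finset.sum_sub_distrib]
        exact Finset.sum_congr rfl fun b _ => by simp only [he]; ring
      have heb : e b = 0 := by
        by_cases hbb : b = b₀
        · rw [hbb, he₀]
        · refine hsub b₀ hb₀ e (fun n => ?_) b (Finset.mem_erase.2 ⟨hbb, hb⟩)
          rw [← hesum n, ← Finset.add_sum_erase _ _ hb₀, he₀, zero_mul, zero_add]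
      have := congrArg σ (sub_eq_zero.1 heb)
      rwa [σ.apply_symm_apply, map_mul, σ.apply_symm_apply] at this

theorem NormIndep.exists_sum_eq [DecidableEq L] {Γ : Finset L} (hΓ : NormIndep σ Γ) {z g : L}
    (hz : z ≠ 0)
    (h : σ z * g * z⁻¹ ∉ Γ → ¬ NormIndep σ (insert (σ z * g * z⁻¹) Γ)) :
    ∃ w : L → L, z = ∑ b ∈ Γ, w b ∧ ∀ b ∈ Γ, w b ≠ 0 → b = σ (w b) * g * (w b)⁻¹ := by
  set b' := σ z * g * z⁻¹ with hb'
  by_cases hmem : b' ∈ Γ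
  · refine ⟨fun b => if b = b' then z else 0, by simp [hmem], fun b _ hwb => ?_⟩
    have hbb : b = b' := by
      by_contra hne
      simp [hne] at hwb
    simpa [hbb] using hb'
  obtain ⟨c, b₀, hb₀, hc1, hc, hconj⟩ := exists_conj_relation (h hmem)
  have hcb' : c b' ≠ 0 := fun h0 => by
    rcases Finset.mem_insert.1 hb₀ with rfl | hb₀
    · exact one_ne_zero (hc1.symm.trans h0)
    · refine one_ne_zero (hc1.symm.trans (hΓ c (fun n => ?_) b₀ hb₀))
      rw [← hc n, Finset.sum_insert hmem, h0, zero_mul, zero_add]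
  refine ⟨fun b => -(c b * z / c b'), ?_, fun b hb hwb => ?_⟩
  · have h0 := hc 0
    simp only [skewNorm, mul_one, Finset.sum_insert hmem] at h0
    rw [Finset.sum_neg_distrib, ← Finset.sum_div, ← Finset.sum_mul,
      eq_neg_of_add_eq_zero_right h0]
    field_simp
  · have hcb : c b ≠ 0 := fun h0 => hwb (by simp [h0])
    have h₁ := hconj b (Finset.mem_insert_of_mem hb)
    have h₂ := hconj b' (Finset.mem_insert_self _ _)
    have hσ : σ (c b') ≠ 0 := (map_ne_zero σ).2 hcb'
    have h₃ : b' * z = σ z * g := by rw [hb']; field_simp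
    clear_value b'
    simp only [map_neg, map_div₀, map_mul]
    field_simp
    linear_combination z * σ (c b') * h₁ - z * σ (c b) * h₂ + σ (c b) * c b' * h₃

end NormIndep

section Cyclic

variable {G : Type*} [CommGroup G] {g : G}

theorem exists_pow_mul_pow_eq_of_generator (hg : ∀ x, x ∈ Subgroup.zpowers g) {k : ℕ}
    (hk : 0 < k.gcd (Nat.card G)) (x : G) :
    ∃ i < k.gcd (Nat.card G), ∃ c : G, c ^ k * g ^ i = x := by
  obtain ⟨j, rfl⟩ := Subgroup.mem_zpowers_iff.1 (hg x)
  set N := k.gcd (Nat.card G) with hN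
  have hN0 : (N : ℤ) ≠ 0 := by exact_mod_cast hk.ne'
  obtain ⟨i, hi⟩ := Int.eq_ofNat_of_zero_le (Int.emod_nonneg j hN0)
  refine ⟨i, ?_, g ^ (k.gcdA (Nat.card G) * (j / N)), ?_⟩
  · have := Int.emod_lt_of_pos j (Int.natCast_pos.2 hk)
    omega
  · have hn : g ^ (Nat.card G : ℤ) = 1 := by rw [zpow_natCast, pow_card_eq_one']
    have hj : j = k.gcdA (Nat.card G) * (j / N) * k + i
        + Nat.card G * (k.gcdB (Nat.card G) * (j / N)) := by
      have h₁ := Nat.gcd_eq_gcd_ab k (Nat.card G)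
      have h₂ := Int.mul_ediv_add_emod j N
      rw [← hN] at h₁
      rw [hi] at h₂
      linear_combination (j / N) * h₁ - h₂
    conv_rhs => rw [hj, zpow_add, zpow_add, zpow_mul g (Nat.card G : ℤ), hn, one_zpow, mul_one]
    rw [zpow_mul _ _ (k : ℤ), zpow_natCast, zpow_natCast]

theorem eq_of_pow_mul_pow_eq_of_generator (hg : ∀ x, x ∈ Subgroup.zpowers g) {k i j : ℕ}
    (hi : i < k.gcd (Nat.card G)) (hj : j < k.gcd (Nat.card G)) {c e : G}
    (h : c ^ k * g ^ i = e ^ k * g ^ j) : i = j := by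
  obtain ⟨a, rfl⟩ := Subgroup.mem_zpowers_iff.1 (hg c)
  obtain ⟨b, rfl⟩ := Subgroup.mem_zpowers_iff.1 (hg e)
  simp only [← zpow_natCast, ← zpow_mul, ← zpow_add] at h
  rw [zpow_eq_zpow_iff_modEq, orderOf_eq_card_of_forall_mem_zpowers hg] at h
  have hdvd : ((k.gcd (Nat.card G) : ℕ) : ℤ) ∣ b * k + j - (a * k + i) :=
    (Int.natCast_dvd_natCast.2 (Nat.gcd_dvd_right k _)).trans h.dvd
  have hk : ((k.gcd (Nat.card G) : ℕ) : ℤ) ∣ k := Int.natCast_dvd_natCast.2 (Nat.gcd_dvd_left k _)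
  have hij : ((k.gcd (Nat.card G) : ℕ) : ℤ) ∣ j - i := by
    have := dvd_sub hdvd (hk.mul_left (b - a))
    rwa [show b * k + j - (a * k + i) - (b - a) * (k : ℤ) = j - i by ring] at this
  exact ((Nat.modEq_iff_dvd.2 hij).eq_of_lt_of_lt hi hj)

end Cyclic

section FiniteField

variable {L : Type*} [Field L]

/-- The fixed field of an automorphism. -/
abbrev fixedSubfield (σ : L ≃+* L) : Subfield L :=
  (σ : L →+* L).eqLocusField (RingHom.id L)

theorem NormIndep.linearIndependent {σ : L ≃+* L} {Γ : Finset L} (h : NormIndep σ Γ) {g : L}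
    {c : L → L} (hc0 : ∀ b ∈ Γ, c b ≠ 0) (hc : ∀ b ∈ Γ, b = σ (c b) * g * (c b)⁻¹) :
    LinearIndependent (fixedSubfield σ) fun b : Γ => c b := by
  classical
  rw [Fintype.linearIndependent_iff]
  intro t ht b
  let t' : L → L := fun b => if hb : b ∈ Γ then t ⟨b, hb⟩ else 0
  have ht' : ∀ b (hb : b ∈ Γ), t' b = t ⟨b, hb⟩ := fun b hb => dif_pos hb
  have h0 := h.eq_zero_of_sum_mul_eq_zero hc0 hc (t := t')
    (fun b hb => by rw [ht' b hb]; exact (t ⟨b, hb⟩).2) (by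
      rw [← Finset.sum_coe_sort, ← ht]
      exact Finset.sum_congr rfl fun b _ => by rw [ht' b b.2]; rfl) b b.2
  rw [ht' b b.2] at h0
  exact Subtype.ext h0

theorem card_fixedSubfield [Finite L] {σ : L ≃+* L} {p s n : ℕ} (hp : 0 < p)
    (hσ : ∀ a, σ a = a ^ p ^ s) (hcard : Nat.card L = p ^ n) :
    Nat.card (fixedSubfield σ) = p ^ s.gcd n := by
  have hiff : ∀ a : L, a ≠ 0 → (σ a = a ↔ a ^ (p ^ s - 1) = 1) := fun a ha => by
    rw [hσ]
    conv_lhs => rw [← Nat.sub_add_cancel (Nat.pos_of_ne_zero (pow_pos hp s).ne'), pow_succ]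
    exact mul_eq_right₀ ha
  have hker : Nat.card (fixedSubfield σ)ˣ =
      Nat.card (powMonoidHom (p ^ s - 1) : Lˣ →* Lˣ).ker := by
    refine Nat.card_congr
      { toFun := fun u => ⟨Units.map (fixedSubfield σ).subtype u, ?_⟩
        invFun := fun v => Units.mk0 ⟨(v : Lˣ), (hiff _ (v : Lˣ).ne_zero).2 ?_⟩ ?_
        left_inv := fun u => by ext; rfl
        right_inv := fun v => by ext; rfl }
    · have := (hiff ((u : fixedSubfield σ) : L) (by simp)).1 (u : fixedSubfield σ).2
      exact MonoidHom.mem_ker.2 (Units.ext this)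
    · exact congrArg Units.val (MonoidHom.mem_ker.1 v.2)
    · exact fun h0 => (v : Lˣ).ne_zero (congrArg Subtype.val h0)
  rw [IsCyclic.card_powMonoidHom_ker, Nat.card_units, Nat.card_units, hcard,
    Nat.pow_sub_one_gcd_pow_sub_one, Nat.gcd_comm] at hker
  have h₁ : 0 < Nat.card (fixedSubfield σ) := Nat.card_pos
  have h₂ : 0 < p ^ s.gcd n := pow_pos hp _
  omega

theorem finrank_fixedSubfield [Finite L] {σ : L ≃+* L} {p s n : ℕ} (hp : 1 < p) (hs : 0 < s)
    (hσ : ∀ a, σ a = a ^ p ^ s) (hcard : Nat.card L = p ^ n) :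
    Module.finrank (fixedSubfield σ) L = n / s.gcd n := by
  have h := Module.natCard_eq_pow_finrank (K := fixedSubfield σ) (V := L)
  rw [hcard, card_fixedSubfield (by omega) hσ hcard, ← pow_mul] at h
  exact (Nat.div_eq_of_eq_mul_right (Nat.gcd_pos_of_pos_left _ hs)
    (Nat.pow_right_injective hp h)).symm

theorem exists_unit_generator {γ : L} (hγ : ∀ b : L, b ≠ 0 → ∃ j : ℕ, γ ^ j = b) {N : ℕ}
    (hN : N ∣ Nat.card Lˣ) :
    ∃ g : Lˣ, (∀ x, x ∈ Subgroup.zpowers g) ∧ ∀ i < N, γ ^ i = (g : L) ^ i := by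
  by_cases h0 : γ = 0
  · have hone : ∀ x : Lˣ, x = 1 := fun x => by
      obtain ⟨j, hj⟩ := hγ x x.ne_zero
      rcases Nat.eq_zero_or_pos j with rfl | hj0
      · exact Units.ext (by simpa using hj.symm)
      · rw [h0, zero_pow hj0.ne'] at hj
        exact absurd hj.symm x.ne_zero
    refine ⟨1, fun x => by rw [hone x]; exact Subgroup.one_mem _, fun i hi => ?_⟩
    have : Subsingleton Lˣ := ⟨fun x y => (hone x).trans (hone y).symm⟩
    rw [Nat.card_of_subsingleton (1 : Lˣ), Nat.dvd_one] at hN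
    obtain rfl : i = 0 := by omega
    simp
  · refine ⟨Units.mk0 γ h0, fun x => ?_, fun i _ => rfl⟩
    obtain ⟨j, hj⟩ := hγ x x.ne_zero
    exact ⟨j, Units.ext (by simpa using hj)⟩

theorem conj_eq_pow_mul {σ : L ≃+* L} {q : ℕ} (hq : 0 < q) (hσ : ∀ a, σ a = a ^ q) (g : L)
    {c : L} (hc : c ≠ 0) : σ c * g * c⁻¹ = c ^ (q - 1) * g := by
  have h : c ^ q = c ^ (q - 1) * c := by rw [← pow_succ, Nat.sub_add_cancel hq]
  rw [hσ, h]
  field_simp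

end FiniteField

/-- Proposition 19 of the paper: over `L = F_{q^m}` (`q = p^d`) with
`σ : a ↦ a^{p^s}` of order `μ = dm/δ` (`δ = gcd(s, dm)`) and fixed field
`K = F_{p^δ}`, every maximal left P-independent subset of `L*` is of the form
`{ σ (cc i j) * γ^i * (cc i j)⁻¹ : 0 ≤ i ≤ p^δ - 2, 0 ≤ j ≤ μ - 1 }` for a
primitive element `γ` and `K`-bases `(cc i 0, …, cc i (μ-1))` of `L`; consequently
every left P-independent subset of `L*` has at most `(p^δ - 1) * μ` elements. -/
theorem maximal_pindependent_sets_finite_field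
    {L : Type*} [Field L] [Fintype L]
    (p d m s dd μ : ℕ) (hprime : Nat.Prime p) (hd : 0 < d) (hm : 0 < m)
    (hcard : Fintype.card L = p ^ (d * m))
    (hs1 : 1 ≤ s) (hs2 : s ≤ m * d)
    (hdd : dd = Nat.gcd s (d * m)) (hμ : μ = d * m / dd)
    (σ : L ≃+* L) (hσ : ∀ a : L, σ a = a ^ p ^ s)
    {R : Type*} [Ring R] (C : L →+* R) (X : R)
    (H : IsOreExtension σ (fun _ => 0) R C X)
    (γ : L) (hγ : ∀ b : L, b ≠ 0 → ∃ j : ℕ, γ ^ j = b)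
    (Γ : Finset L) (hΓ0 : ∀ b ∈ Γ, b ≠ 0) (hPI : PIndepF H Γ)
    (hmax : ∀ Γ' : Finset L, (∀ b ∈ Γ', b ≠ 0) → PIndepF H Γ' → Γ ⊆ Γ' → Γ' = Γ) :
    (∃ cc : Fin (p ^ dd - 1) → Fin μ → L,
      (∀ i, (∀ t : Fin μ → L, (∀ j, σ (t j) = t j) → ∑ j, t j * cc i j = 0 → ∀ j, t j = 0) ∧
        (∀ z : L, ∃ t : Fin μ → L, (∀ j, σ (t j) = t j) ∧ z = ∑ j, t j * cc i j)) ∧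
      (↑Γ : Set L) =
        {b : L | ∃ (i : Fin (p ^ dd - 1)) (j : Fin μ),
          b = σ (cc i j) * γ ^ (i : ℕ) * (cc i j)⁻¹}) ∧
    (∀ Γ' : Finset L, (∀ b ∈ Γ', b ≠ 0) → PIndepF H Γ' → Γ'.card ≤ (p ^ dd - 1) * μ) := by
  classical
  have hp : 0 < p := hprime.pos
  have hcard' : Nat.card L = p ^ (d * m) := by rw [Nat.card_eq_fintype_card, hcard]
  have hfin : Module.finrank (fixedSubfield σ) L = μ := by
    rw [finrank_fixedSubfield hprime.one_lt hs1 hσ hcard', hμ, hdd]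
  have hN : p ^ dd - 1 = (p ^ s - 1).gcd (Nat.card Lˣ) := by
    rw [Nat.card_units, hcard', Nat.pow_sub_one_gcd_pow_sub_one, hdd]
  have hdd0 : dd ≠ 0 := hdd ▸ (Nat.gcd_pos_of_pos_left _ hs1).ne'
  have hNpos : 0 < p ^ dd - 1 := Nat.sub_pos_of_lt (Nat.one_lt_pow hdd0 hprime.one_lt)
  obtain ⟨g, hg, hγg⟩ := exists_unit_generator hγ (hN ▸ Nat.gcd_dvd_right _ _)
  have hclass : ∀ b : L, b ≠ 0 → ∃ i < p ^ dd - 1, ∃ c : L, c ≠ 0 ∧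
      b = σ c * γ ^ i * c⁻¹ := fun b hb => by
    obtain ⟨i, hi, c, hc⟩ := exists_pow_mul_pow_eq_of_generator hg (hN ▸ hNpos) (Units.mk0 b hb)
    rw [← hN] at hi
    refine ⟨i, hi, c, c.ne_zero, ?_⟩
    rw [conj_eq_pow_mul (pow_pos hp s) hσ _ c.ne_zero, hγg i hi]
    simpa using (congrArg Units.val hc).symm
  have hunique : ∀ i < p ^ dd - 1, ∀ j < p ^ dd - 1, ∀ c e : L, c ≠ 0 → e ≠ 0 →
      σ c * γ ^ i * c⁻¹ = σ e * γ ^ j * e⁻¹ → i = j := fun i hi j hj c e hc he h => by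
    rw [conj_eq_pow_mul (pow_pos hp s) hσ _ hc, conj_eq_pow_mul (pow_pos hp s) hσ _ he,
      hγg i hi, hγg j hj] at h
    refine eq_of_pow_mul_pow_eq_of_generator hg (hN ▸ hi) (hN ▸ hj)
      (c := Units.mk0 c hc) (e := Units.mk0 e he) (Units.ext ?_)
    simpa using h
  have hγ0 : ∀ i < p ^ dd - 1, γ ^ i ≠ 0 := fun i hi => by
    rw [hγg i hi]
    exact pow_ne_zero _ g.ne_zero
  choose! cls hcls rep hrep hbrep using hclass
  have hind : ∀ Γ' : Finset L, (∀ b ∈ Γ', b ≠ 0) → PIndepF H Γ' → ∀ i,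
      LinearIndependent (fixedSubfield σ) fun b : Γ'.filter (cls · = i) => rep b := by
    intro Γ' h0 hPI' i
    refine ((H.pIndepF_iff.1 hPI').subset (Finset.filter_subset _ _)).linearIndependent
      (g := γ ^ i) (fun b hb => hrep b (h0 b (Finset.mem_filter.1 hb).1)) fun b hb => ?_
    obtain ⟨hbΓ, rfl⟩ := Finset.mem_filter.1 hb
    exact hbrep b (h0 b hbΓ)
  refine ⟨?_, fun Γ' h0 hPI' => ?_⟩
  · have hspan : ∀ i : Fin (p ^ dd - 1), ⊤ ≤ Submodule.span (fixedSubfield σ)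
        (Set.range fun b : Γ.filter (cls · = (i : ℕ)) => rep b) := by
      rintro i z -
      by_cases hz : z = 0
      · exact hz ▸ Submodule.zero_mem _
      obtain ⟨w, hzw, hw⟩ := (H.pIndepF_iff.1 hPI).exists_sum_eq (z := z) (g := γ ^ (i : ℕ)) hz
        fun hmem hins => hmem <| by
          have h := hmax _ (fun b hb => by
            rcases Finset.mem_insert.1 hb with rfl | hb
            · exact mul_ne_zero (mul_ne_zero ((map_ne_zero σ).2 hz) (hγ0 i i.2)) (inv_ne_zero hz)
            · exact hΓ0 b hb) (H.pIndepF_iff.2 hins) (Finset.subset_insert _ _)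
          exact h ▸ Finset.mem_insert_self _ _
      rw [hzw]
      refine Submodule.sum_mem _ fun b hb => ?_
      by_cases hwb : w b = 0
      · exact hwb ▸ Submodule.zero_mem _
      have hb0 := hΓ0 b hb
      have hrb := hrep b hb0
      have hconj : σ (rep b) * γ ^ cls b * (rep b)⁻¹ = σ (w b) * γ ^ (i : ℕ) * (w b)⁻¹ :=
        (hbrep b hb0).symm.trans (hw b hb hwb)
      have hi : cls b = i := hunique _ (hcls b hb0) _ i.2 _ _ hrb hwb hconj
      have hfix : σ (w b / rep b) = w b / rep b := by
        rw [hi] at hconj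
        have h₁ := hγ0 i i.2
        have h₂ : σ (rep b) ≠ 0 := (map_ne_zero σ).2 hrb
        rw [map_div₀, div_eq_div_iff h₂ hrb]
        field_simp at hconj
        linear_combination -hconj
      have hsmul : w b = (⟨w b / rep b, hfix⟩ : fixedSubfield σ) • rep b :=
        (div_mul_cancel₀ _ hrb).symm
      rw [hsmul]
      exact Submodule.smul_mem _ _
        (Submodule.subset_span ⟨⟨b, Finset.mem_filter.2 ⟨hb, hi⟩⟩, rfl⟩)
    have hbasis : ∀ i : Fin (p ^ dd - 1), ∃ (B : Module.Basis (Fin μ) (fixedSubfield σ) L)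
        (e : Γ.filter (cls · = (i : ℕ)) ≃ Fin μ), ∀ b, B (e b) = rep b := fun i => by
      let B₀ := Module.Basis.mk (hind Γ hΓ0 hPI i) (hspan i)
      let e := Fintype.equivFinOfCardEq ((Module.finrank_eq_card_basis B₀).symm.trans hfin)
      refine ⟨B₀.reindex e, e, fun b => ?_⟩
      rw [Module.Basis.reindex_apply, e.symm_apply_apply, Module.Basis.mk_apply]
    choose B e hBe using hbasis
    refine ⟨fun i j => B i j, fun i => ⟨fun t ht hsum j => ?_, fun z => ?_⟩, ?_⟩
    · exact congrArg Subtype.val (Fintype.linearIndependent_iff.1 (B i).linearIndependent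
        (fun j => ⟨t j, ht j⟩) hsum j)
    · exact ⟨fun j => ((B i).repr z j : L), fun j => ((B i).repr z j).2, ((B i).sum_repr z).symm⟩
    · ext b
      simp only [Finset.mem_coe, Set.mem_ofPred_eq]
      refine ⟨fun hb => ?_, ?_⟩
      · have hb0 := hΓ0 b hb
        refine ⟨⟨cls b, hcls b hb0⟩, e ⟨cls b, hcls b hb0⟩ ⟨b, Finset.mem_filter.2 ⟨hb, rfl⟩⟩, ?_⟩
        rw [hBe]
        exact hbrep b hb0
      · rintro ⟨i, j, rfl⟩
        obtain ⟨⟨b, hbm⟩, rfl⟩ := (e i).surjective j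
        obtain ⟨hb, hbi⟩ := Finset.mem_filter.1 hbm
        have h := hbrep b (hΓ0 b hb)
        rw [hbi] at h
        rw [hBe, ← h]
        exact hb
  · rw [Finset.card_eq_sum_card_fiberwise (f := cls) (t := Finset.range (p ^ dd - 1))
      fun b hb => Finset.mem_coe.2 (Finset.mem_range.2 (hcls b (h0 b hb)))]
    refine (Finset.sum_le_card_nsmul _ _ μ fun i _ => ?_).trans (by simp)
    have := (hind Γ' h0 hPI' i).fintype_card_le_finrank
    rwa [hfin, Fintype.card_coe] at this
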